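/- (A₂-type cluster identity for the characteristic-p infinitesimal dilogarithm.) Let p be an odd prime and k a field of characteristic p. Let y₁, y₂ be units of k₂ = k[t]/(t²) such that each of the five elements y₁, y₂(1−y₁), y₁⁻¹(1−y₂+y₁y₂), y₁⁻¹(1−y₂⁻¹), y₂⁻¹ lies in k₂^♭. Then ℓi₂^{(p)}(y₁) + ℓi₂^{(p)}(y₂(1−y₁)) + ℓi₂^{(p)}(y₁⁻¹(1−y₂+y₁y₂)) + ℓi₂^{(p)}(y₁⁻¹(1−y₂⁻¹)) + ℓi₂^{(p)}(y₂⁻¹) = 0. -/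

import Mathlib

open TrivSqZeroExt

/-- Kontsevich's 1½-logarithm `£₁(s) = Σ_{i=1}^{p−1} s^i / i`. -/
noncomputable def kontsevichLog (p : ℕ) {k : Type*} [Field k] (s : k) : k :=
  ∑ i ∈ Finset.Icc 1 (p - 1), s ^ i / (i : k)

/-- The characteristic-`p` infinitesimal dilogarithm `ℓi₂^{(p)}(s + αt) = (α/(s(1−s)))^p · £₁(s)`
on the dual numbers `k₂ = k[t]/(t²)`. -/
noncomputable def li2p (p : ℕ) {k : Type*} [Field k] (y : DualNumber k) : k :=
  (y.snd / (y.fst * (1 - y.fst))) ^ p * kontsevichLog p y.fst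

/-- `y = s + αt ∈ k₂` lies in `k₂^♭` iff `s(1−s) ≠ 0`. -/
def IsFlat {k : Type*} [Field k] (y : DualNumber k) : Prop :=
  y.fst * (1 - y.fst) ≠ 0

/-- The integral polynomial `((u + v) ^ p - u ^ p - v ^ p) / p`, evaluated in a commutative ring. -/
def dividedFrobeniusDefect (p : ℕ) {R : Type*} [CommRing R] (u v : R) : R :=
  ∑ i ∈ Finset.Icc 1 (p - 1), u ^ i * v ^ (p - i) * ((p.choose i / p : ℕ) : R)

section DividedFrobeniusDefect

variable {p : ℕ} {R S : Type*} [CommRing R] [CommRing S]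

lemma map_dividedFrobeniusDefect (f : R →+* S) (u v : R) :
    f (dividedFrobeniusDefect p u v) = dividedFrobeniusDefect p (f u) (f v) := by
  simp [dividedFrobeniusDefect]

lemma natCast_mul_dividedFrobeniusDefect (hp : p.Prime) (u v : R) :
    (p : R) * dividedFrobeniusDefect p u v = (u + v) ^ p - u ^ p - v ^ p := by
  have hsum : (p : R) * dividedFrobeniusDefect p u v
      = ∑ i ∈ Finset.Ico 1 p, u ^ i * v ^ (p - i) * (p.choose i : R) := by
    have hIcc : Finset.Icc 1 (p - 1) = Finset.Ico 1 p := by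
      ext i
      have := hp.pos
      simp only [Finset.mem_Icc, Finset.mem_Ico]
      omega
    rw [dividedFrobeniusDefect, hIcc, Finset.mul_sum]
    refine Finset.sum_congr rfl fun i hi => ?_
    rw [Finset.mem_Ico] at hi
    have hdvd : p ∣ p.choose i := hp.dvd_choose_self (by omega) hi.2
    rw [mul_left_comm, ← Nat.cast_mul, Nat.mul_div_cancel' hdvd]
  rw [hsum, add_pow, Finset.sum_range_succ, Finset.range_eq_Ico,
    Finset.sum_eq_sum_Ico_succ_bot hp.pos]
  simp

/-- The divided Frobenius defect is a 2-cocycle. The identity is checked in a polynomial ring over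
`ℤ`, which has no torsion, and then specialized. -/
lemma dividedFrobeniusDefect_cocycle (hp : p.Prime) (x y z : R) :
    dividedFrobeniusDefect p x y + dividedFrobeniusDefect p (x + y) z
      = dividedFrobeniusDefect p y z + dividedFrobeniusDefect p x (y + z) := by
  let X : R → MvPolynomial R ℤ := MvPolynomial.X
  have key : dividedFrobeniusDefect p (X x) (X y) + dividedFrobeniusDefect p (X x + X y) (X z)
      = dividedFrobeniusDefect p (X y) (X z) + dividedFrobeniusDefect p (X x) (X y + X z) := by
    apply mul_left_cancel₀ (Nat.cast_ne_zero.mpr hp.ne_zero : (p : MvPolynomial R ℤ) ≠ 0)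
    simp only [mul_add, natCast_mul_dividedFrobeniusDefect hp]
    ring
  simpa only [X, map_add, map_neg, map_dividedFrobeniusDefect, MvPolynomial.eval₂Hom_X', id] using
    congrArg (MvPolynomial.eval₂Hom (Int.castRingHom R) id) key

lemma dividedFrobeniusDefect_comm (hp : p.Prime) (x y : R) :
    dividedFrobeniusDefect p x y = dividedFrobeniusDefect p y x := by
  let X : R → MvPolynomial R ℤ := MvPolynomial.X
  have key : dividedFrobeniusDefect p (X x) (X y) = dividedFrobeniusDefect p (X y) (X x) := by
    apply mul_left_cancel₀ (Nat.cast_ne_zero.mpr hp.ne_zero : (p : MvPolynomial R ℤ) ≠ 0)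
    simp only [natCast_mul_dividedFrobeniusDefect hp]
    ring
  simpa only [X, map_add, map_neg, map_dividedFrobeniusDefect, MvPolynomial.eval₂Hom_X', id] using
    congrArg (MvPolynomial.eval₂Hom (Int.castRingHom R) id) key

lemma dividedFrobeniusDefect_add_neg (hp : p.Prime) (hodd : Odd p) (x y : R) :
    dividedFrobeniusDefect p (x + y) (-y) = -dividedFrobeniusDefect p x y := by
  let X : R → MvPolynomial R ℤ := MvPolynomial.X
  have key : dividedFrobeniusDefect p (X x + X y) (-X y)
      = -dividedFrobeniusDefect p (X x) (X y) := by
    apply mul_left_cancel₀ (Nat.cast_ne_zero.mpr hp.ne_zero : (p : MvPolynomial R ℤ) ≠ 0)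
    simp only [mul_neg, natCast_mul_dividedFrobeniusDefect hp, hodd.neg_pow]
    ring
  simpa only [X, map_add, map_neg, map_dividedFrobeniusDefect, MvPolynomial.eval₂Hom_X', id] using
    congrArg (MvPolynomial.eval₂Hom (Int.castRingHom R) id) key

lemma pow_mul_dividedFrobeniusDefect (c u v : R) :
    c ^ p * dividedFrobeniusDefect p u v = dividedFrobeniusDefect p (c * u) (c * v) := by
  rw [dividedFrobeniusDefect, dividedFrobeniusDefect, Finset.mul_sum]
  refine Finset.sum_congr rfl fun i hi => ?_
  rw [Finset.mem_Icc] at hi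
  have hpow : c ^ p = c ^ i * c ^ (p - i) := by rw [← pow_add]; congr 1; omega
  rw [mul_pow, mul_pow, hpow]
  ring

end DividedFrobeniusDefect

section KontsevichLog

variable {p : ℕ} {k : Type*} [Field k] [CharP k p]

lemma cast_choose_prime_sub_one (hp : p.Prime) {j : ℕ} (hj : j < p) :
    ((p - 1).choose j : k) = (-1) ^ j := by
  induction j with
  | zero => simp
  | succ j ih =>
    have hpascal : p.choose (j + 1) = (p - 1).choose j + (p - 1).choose (j + 1) := by
      rw [← Nat.choose_succ_succ, Nat.succ_eq_add_one, Nat.sub_add_cancel hp.one_le]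
    have hzero : (p.choose (j + 1) : k) = 0 :=
      (CharP.cast_eq_zero_iff k p _).mpr (hp.dvd_choose_self j.succ_ne_zero hj)
    rw [hpascal, Nat.cast_add, ih (by omega)] at hzero
    rw [pow_succ]
    linear_combination hzero

lemma cast_choose_prime_div (hp : p.Prime) {i : ℕ} (hi : 1 ≤ i) (hip : i < p) :
    ((p.choose i / p : ℕ) : k) = (-1) ^ (i - 1) / (i : k) := by
  have hik : (i : k) ≠ 0 := fun h =>
    Nat.not_dvd_of_pos_of_lt hi hip ((CharP.cast_eq_zero_iff k p i).mp h)
  have hnat : p.choose i / p * i = (p - 1).choose (i - 1) := by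
    obtain ⟨c, hc⟩ := hp.dvd_choose_self (by omega : i ≠ 0) hip
    have hmul := Nat.add_one_mul_choose_eq (p - 1) (i - 1)
    rw [Nat.sub_add_cancel hp.one_le, Nat.sub_add_cancel hi, hc, mul_assoc] at hmul
    rw [hc, Nat.mul_div_cancel_left _ hp.pos]
    exact (Nat.eq_of_mul_eq_mul_left hp.pos hmul).symm
  rw [eq_div_iff hik, ← Nat.cast_mul, hnat, cast_choose_prime_sub_one hp (by omega)]

lemma kontsevichLog_eq_dividedFrobeniusDefect (hp : p.Prime) (hodd : Odd p) (s : k) :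
    kontsevichLog p s = dividedFrobeniusDefect p s (1 - s) := by
  have hneg := dividedFrobeniusDefect_add_neg hp hodd (1 - s) s
  rw [sub_add_cancel, dividedFrobeniusDefect_comm hp 1, dividedFrobeniusDefect_comm hp (1 - s)]
    at hneg
  rw [← neg_inj, ← hneg, kontsevichLog, dividedFrobeniusDefect, ← Finset.sum_neg_distrib]
  refine Finset.sum_congr rfl fun i hi => ?_
  rw [Finset.mem_Icc] at hi
  rw [cast_choose_prime_div hp hi.1 (by omega), one_pow, neg_pow s]
  obtain ⟨j, rfl⟩ : ∃ j, i = j + 1 := ⟨i - 1, by omega⟩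
  have hsq : ((-1 : k) ^ j) * (-1) ^ j = 1 := by rw [← mul_pow]; simp
  rw [Nat.add_sub_cancel, pow_succ (-1 : k)]
  linear_combination (s ^ (j + 1) / ((j + 1 : ℕ) : k)) * hsq

lemma kontsevichLog_one_sub (hp : p.Prime) (hodd : Odd p) (s : k) :
    kontsevichLog p (1 - s) = kontsevichLog p s := by
  rw [kontsevichLog_eq_dividedFrobeniusDefect hp hodd,
    kontsevichLog_eq_dividedFrobeniusDefect hp hodd, dividedFrobeniusDefect_comm hp, sub_sub_cancel]

lemma pow_mul_kontsevichLog_div (hp : p.Prime) (hodd : Odd p) {c : k} (hc : c ≠ 0) (s : k) :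
    c ^ p * kontsevichLog p (s / c) = dividedFrobeniusDefect p s (c - s) := by
  rw [kontsevichLog_eq_dividedFrobeniusDefect hp hodd, pow_mul_dividedFrobeniusDefect,
    mul_sub, mul_one, mul_div_cancel₀ _ hc]

lemma pow_mul_kontsevichLog_inv (hp : p.Prime) (hodd : Odd p) {s : k} (hs : s ≠ 0) :
    s ^ p * kontsevichLog p s⁻¹ = -kontsevichLog p s := by
  rw [inv_eq_one_div, pow_mul_kontsevichLog_div hp hodd hs,
    kontsevichLog_eq_dividedFrobeniusDefect hp hodd, ← dividedFrobeniusDefect_add_neg hp hodd]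
  congr 1 <;> ring

/-- The four-term functional equation of the `1½`-logarithm. -/
lemma kontsevichLog_four_term (hp : p.Prime) (hodd : Odd p) {x : k} (hx : x ≠ 0)
    (hx' : 1 - x ≠ 0) (y : k) :
    kontsevichLog p x - kontsevichLog p y + x ^ p * kontsevichLog p (y / x)
      + (1 - x) ^ p * kontsevichLog p ((1 - y) / (1 - x)) = 0 := by
  rw [pow_mul_kontsevichLog_div hp hodd hx, pow_mul_kontsevichLog_div hp hodd hx',
    kontsevichLog_eq_dividedFrobeniusDefect hp hodd, kontsevichLog_eq_dividedFrobeniusDefect hp hodd]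
  have hcocycle := dividedFrobeniusDefect_cocycle hp y (x - y) (1 - x)
  have hneg := dividedFrobeniusDefect_add_neg hp hodd (1 - x) (x - y)
  rw [dividedFrobeniusDefect_comm hp (1 - x)] at hneg
  ring_nf at hcocycle hneg ⊢
  linear_combination hcocycle + hneg

/-- The four-term functional equation for `u`, `v` and their transforms `(1 - v) / u`,
`(1 - u) / v`. -/
lemma kontsevichLog_four_term_quotients (hp : p.Prime) (hodd : Odd p) {u v : k} (hu : u ≠ 0)
    (hu' : 1 - u ≠ 0) (hv : v ≠ 0) :
    v ^ p * kontsevichLog p ((1 - u) / v) - kontsevichLog p u + kontsevichLog p v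
      - u ^ p * kontsevichLog p ((1 - v) / u) = 0 := by
  have hfour := kontsevichLog_four_term hp hodd hu' (by rwa [sub_sub_cancel]) v
  rw [sub_sub_cancel, kontsevichLog_one_sub hp hodd] at hfour
  have hinv := pow_mul_kontsevichLog_inv hp hodd (div_ne_zero hv hu')
  rw [inv_div, div_pow, div_mul_eq_mul_div, div_eq_iff (pow_ne_zero p hu')] at hinv
  linear_combination hinv - hfour

end KontsevichLog

/-- The A₂-type cluster identity for the characteristic-`p` infinitesimal dilogarithm. -/
theorem li2p_A2_cluster (p : ℕ) (hp : p.Prime) (hodd : Odd p)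
    (k : Type*) [Field k] [CharP k p] (y₁ y₂ : DualNumber k)
    (h₁ : IsUnit y₁) (h₂ : IsUnit y₂)
    (f₁ : IsFlat y₁) (f₂ : IsFlat (y₂ * (1 - y₁)))
    (f₃ : IsFlat (y₁⁻¹ * (1 - y₂ + y₁ * y₂))) (f₄ : IsFlat (y₁⁻¹ * (1 - y₂⁻¹)))
    (f₅ : IsFlat y₂⁻¹) :
    li2p p y₁ + li2p p (y₂ * (1 - y₁)) + li2p p (y₁⁻¹ * (1 - y₂ + y₁ * y₂))
      + li2p p (y₁⁻¹ * (1 - y₂⁻¹)) + li2p p y₂⁻¹ = 0 := by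
  have := Fact.mk hp
  have hb : y₂.fst ≠ 0 := (isUnit_iff_isUnit_fst.mp h₂).ne_zero
  clear h₁ h₂
  simp only [IsFlat, li2p, fst_mul, fst_sub, fst_add, fst_one, fst_inv, snd_mul, snd_sub, snd_add,
    snd_one, snd_inv, smul_eq_mul, MulOpposite.smul_eq_mul_unop, MulOpposite.unop_op] at *
  generalize y₁.fst = a, y₁.snd = α, y₂.fst = b, y₂.snd = β at *
  obtain ⟨ha, ha'⟩ := mul_ne_zero_iff.mp f₁
  obtain ⟨hu, hu'⟩ := mul_ne_zero_iff.mp f₂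
  have hv := left_ne_zero_of_mul f₃
  obtain ⟨hw, hw'⟩ := mul_ne_zero_iff.mp f₄
  have hb' : 1 - b ≠ 0 := by
    intro h
    obtain rfl : b = 1 := (sub_eq_zero.mp h).symm
    simp at hw
  set u := b * (1 - a) with hu_def
  set v := a⁻¹ * (1 - b + a * b) with hv_def
  set w := a⁻¹ * (1 - b⁻¹) with hw_def
  have hva : (1 - u) / v = a := by
    rw [div_eq_iff hv, hu_def, hv_def]; field_simp; ring
  have hvu : (1 - v) / u = w := by
    rw [div_eq_iff hu, hu_def, hv_def, hw_def]; field_simp; ring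
  have hwv : (1 - w) / v = b⁻¹ := by
    rw [div_eq_iff hv, hv_def, hw_def]; field_simp; ring
  have hvw : (1 - v) / w = u := by
    rw [div_eq_iff hw, hu_def, hv_def, hw_def]; field_simp; ring
  have hA := kontsevichLog_four_term_quotients hp hodd hu hu' hv
  have hB := kontsevichLog_four_term_quotients hp hodd hw hw' hv
  rw [hva, hvu] at hA
  rw [hwv, hvw] at hB
  -- The logarithmic derivatives are combinations of `A` and `B` with coefficients in `u, v, w`.
  set A := α / ((1 - a) * (1 - u)) with hA_def
  set B := β * a / ((1 - b) * (1 - u)) with hB_def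
  have hv_one : 1 - v = -((1 - a) * (1 - b) / a) := by rw [hv_def]; field_simp; ring
  have hw_one : 1 - w = (1 - u) / (a * b) := by rw [hw_def, hu_def]; field_simp; ring
  have hv_eq : v = (1 - u) / a := by rw [hv_def, hu_def]; field_simp; ring
  have hw_eq : w = -((1 - b) / (a * b)) := by rw [hw_def]; field_simp; ring
  have hb_one : 1 - b⁻¹ = -((1 - b) / b) := by field_simp; ring
  have hlog_a : α / (a * (1 - a)) = A * v := by
    rw [hA_def, hv_eq]; field_simp
  have hlog_u : (b * (0 - α) + β * (1 - a)) / (u * (1 - u)) = -A - B * w := by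
    rw [hA_def, hB_def, hw_eq]; field_simp; rw [hu_def]; ring
  have hlog_v : (a⁻¹ * (0 - β + (a * β + α * b)) + -(a⁻¹ * α * a⁻¹) * (1 - b + a * b))
      / (v * (1 - v)) = A + B := by
    rw [hA_def, hB_def, hv_one, hv_eq]; field_simp; ring
  have hlog_w : (a⁻¹ * (0 - -(b⁻¹ * β * b⁻¹)) + -(a⁻¹ * α * a⁻¹) * (1 - b⁻¹))
      / (w * (1 - w)) = -(A * u) - B := by
    rw [hA_def, hB_def, hw_one, hw_eq, hb_one]; field_simp; rw [hu_def]; ring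
  have hlog_b : -(b⁻¹ * β * b⁻¹) / (b⁻¹ * (1 - b⁻¹)) = B * v := by
    rw [hB_def, hv_eq, hb_one]; field_simp
  rw [hlog_a, hlog_u, hlog_v, hlog_w, hlog_b, sub_pow_char, sub_pow_char, add_pow_char,
    hodd.neg_pow, hodd.neg_pow]
  simp only [mul_pow]
  linear_combination A ^ p * hA + B ^ p * hB
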